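/- Let k be a field and A a metabelian k-algebra (the product of any four elements of A is zero) whose derived subalgebra A' has dimension 1 over k. Then there exist a k-vector space P, a bilinear form θ : P × P → k, and an algebra isomorphism from A onto the algebra P_θ on P × k with multiplication (p, x) ⋆ (q, y) := (0, θ(p, q)). -/

import Mathlib

/-- In an algebra with vanishing fourfold products, a line absorbed by left and right
multiplication is annihilated by the algebra on both sides. -/
theorem mul_eq_zero_of_forall_mul_eq_smul
    {k A : Type*} [Field k] [NonUnitalRing A] [Module k A]
    [SMulCommClass k A A] [IsScalarTower k A A]
    (hmet : ∀ x y z t : A, x * y * z * t = 0) {c : A}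
    (hl : ∀ x : A, ∃ r : k, r • c = x * c) (hr : ∀ x : A, ∃ r : k, r • c = c * x) (x : A) :
    x * c = 0 ∧ c * x = 0 := by
  constructor
  · obtain ⟨r, hx⟩ := hl x
    have h : (r * r * r) • c = 0 := by
      rw [← hmet x x x c, mul_assoc, mul_assoc, ← hx, mul_smul_comm, mul_assoc, ← hx,
        mul_smul_comm, ← hx, smul_smul, smul_smul, mul_assoc]
    rw [← hx]
    simpa using h
  · obtain ⟨r, hx⟩ := hr x
    have h : (r * r * r) • c = 0 := by
      rw [← hmet c x x x, ← hx, smul_mul_assoc, smul_mul_assoc, ← hx, smul_mul_assoc, ← hx,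
        smul_smul, smul_smul, mul_assoc]
    rw [← hx]
    simpa using h

/-- A linear form `f` with `f c = 1` splits the space as its kernel times the scalars, the
vector `c` spanning the second factor. -/
def LinearMap.equivKerProd {k A : Type*} [Field k] [AddCommGroup A] [Module k A]
    (f : A →ₗ[k] k) (c : A) (hf : f c = 1) : A ≃ₗ[k] LinearMap.ker f × k where
  toFun a := (⟨a - f a • c, by simp [hf]⟩, f a)
  invFun p := p.1 + p.2 • c
  map_add' a b := by
    ext
    · simp only [map_add, add_smul, Prod.fst_add, Submodule.coe_add]
      abel
    · simp
  map_smul' r a := by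
    ext
    · simp [smul_sub, smul_smul]
    · simp
  left_inv a := by simp
  right_inv p := by
    have hp : f p.1 = 0 := p.1.2
    ext <;> simp [hf, hp]

/-- Every metabelian algebra `A` (the product of any four elements is zero) whose derived
subalgebra `A'` (the span of all products) is `1`-dimensional is isomorphic, as an
algebra, to some `P_θ`: the algebra on `P × k` with multiplication
`(p, x) ⋆ (q, y) = (0, θ (p, q))` for a bilinear form `θ` on a vector space `P`. -/
theorem metabelian_derived_dim_one_iso_Ptheta.{u}
    {k : Type*} [Field k] {A : Type u} [NonUnitalRing A] [Module k A]
    [SMulCommClass k A A] [IsScalarTower k A A]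
    (hmet : ∀ x y z t : A, x * y * z * t = 0)
    (hdim : Module.rank k (Submodule.span k {c : A | ∃ x y : A, c = x * y}) = 1) :
    ∃ (P : Type u) (_ : AddCommGroup P) (_ : Module k P)
      (θ : P →ₗ[k] P →ₗ[k] k) (φ : A ≃ₗ[k] P × k),
      ∀ a b : A, φ (a * b) = (((0 : P), θ (φ a).1 (φ b).1) : P × k) := by
  obtain ⟨c, hc, hc0, hspan⟩ := (rank_submodule_eq_one_iff _).1 hdim
  have hmul (a b : A) : ∃ r : k, r • c = a * b :=
    Submodule.mem_span_singleton.1 (hspan (Submodule.subset_span ⟨a, b, rfl⟩))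
  have hann (x : A) : x * c = 0 ∧ c * x = 0 :=
    mul_eq_zero_of_forall_mul_eq_smul hmet (fun x => hmul x c) (fun x => hmul c x) x
  obtain ⟨f, hf⟩ : ∃ f : A →ₗ[k] k, f c = 1 := by
    obtain ⟨g, hg⟩ : ∃ g : Module.Dual k A, g c ≠ 0 := by
      by_contra! h
      exact hc0 ((Module.forall_dual_apply_eq_zero_iff k c).1 h)
    exact ⟨(g c)⁻¹ • g, by simp [hg]⟩
  refine ⟨LinearMap.ker f, inferInstance, inferInstance,
    ((LinearMap.mul k A).compr₂ f).domRestrict₁₂ (LinearMap.ker f) (LinearMap.ker f),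
    f.equivKerProd c hf, fun a b => ?_⟩
  ext
  · obtain ⟨r, hr⟩ := hmul a b
    simp [LinearMap.equivKerProd, ← hr, hf]
  · change f (a * b) = f ((a - f a • c) * (b - f b • c))
    simp [sub_mul, mul_sub, smul_mul_assoc, mul_smul_comm, hann]
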